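/- Let b = (b_1,…,b_n) be a weakly decreasing sequence of positive integers with b_i − b_{i+1} ≤ 1 for all i and b_n = 1, and let m be an index with 2 ≤ m ≤ n and b_{m−1} = b_m. Let ℓ ≥ 0 with m + ℓ ≤ n, and suppose the monomial x_m x_{m+1} ⋯ x_{m+ℓ} divides a polynomial p ∈ R. Write the class of p in R_b = R/I_b as a ℂ-linear combination of the basis monomials x_1^{j_1} ⋯ x_n^{j_n} with 0 ≤ j_i < b_i. Then x_m x_{m+1} ⋯ x_{m+ℓ} divides every basis monomial occurring with nonzero coefficient in this expansion. -/

import Mathlib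

open MvPolynomial

/-- The complete homogeneous symmetric polynomial of degree `j` in the variables indexed
by the finite set `S`. -/
noncomputable def hset (n : ℕ) (S : Finset (Fin n)) (j : ℕ) : MvPolynomial (Fin n) ℂ :=
  ∑ μ ∈ Finset.univ.filter (fun μ : Sym (Fin n) j => ∀ i ∈ μ, i ∈ S),
    (μ.val.map MvPolynomial.X).prod

/-- The complete homogeneous symmetric polynomial `h_j(x_1, …, x_k)` of degree `j` in the
first `k` variables (these are the 0-based indices `0, …, k-1`). -/
noncomputable def hfirst (n k j : ℕ) : MvPolynomial (Fin n) ℂ :=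
  hset n (Finset.univ.filter (fun i : Fin n => (i : ℕ) < k)) j

/-- The ideal `I_b` generated by `h_{b_1}(x_1), h_{b_2}(x_1,x_2), …, h_{b_n}(x_1,…,x_n)`. -/
noncomputable def Ib {n : ℕ} (b : Fin n → ℕ) : Ideal (MvPolynomial (Fin n) ℂ) :=
  Ideal.span (Set.range fun i : Fin n => hfirst n ((i : ℕ) + 1) (b i))

/-- `b ∈ 𝓑'`: a sequence of positive integers with `b i ≥ b (i+1) ≥ b i - 1` for all `i`. -/
def Bprime {n : ℕ} (b : Fin n → ℕ) : Prop :=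
  (∀ i, 0 < b i) ∧ ∀ (i : ℕ) (h : i + 1 < n),
    b ⟨i + 1, h⟩ ≤ b ⟨i, Nat.lt_of_succ_lt h⟩ ∧
      b ⟨i, Nat.lt_of_succ_lt h⟩ ≤ b ⟨i + 1, h⟩ + 1

namespace MonomialOrder

variable {σ R : Type*}

/-- The colexicographic order on `σ →₀ ℕ`, as a `MonomialOrder`. -/
noncomputable def colex [LinearOrder σ] [WellFoundedLT σ] : MonomialOrder σ where
  syn := Colex (σ →₀ ℕ)
  toSyn :=
  { toEquiv := toColex
    map_add' := fun _ _ => rfl }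
  toSyn_monotone := Finsupp.toColex_monotone

theorem colex_single_le [LinearOrder σ] [WellFoundedLT σ] {s t : σ} (h : s ≤ t) :
    (colex (σ := σ)).toSyn (Finsupp.single s 1) ≤ colex.toSyn (Finsupp.single t 1) :=
  Finsupp.Colex.single_le_iff.2 h

/-- A monomial supported on indices at most `s` is colexicographically bounded by the power of
`X s` of the same degree. -/
theorem colex_le_single_degree [LinearOrder σ] [WellFoundedLT σ] {e : σ →₀ ℕ} {s : σ}
    (h : ∀ t ∈ e.support, t ≤ s) :
    (colex (σ := σ)).toSyn e ≤ colex.toSyn (Finsupp.single s e.degree) := by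
  have h1 : e = ∑ t ∈ e.support, e t • Finsupp.single t 1 := by
    conv_lhs => rw [← e.sum_single]
    simp [Finsupp.sum]
  have h2 : Finsupp.single s e.degree = ∑ t ∈ e.support, e t • Finsupp.single s 1 := by
    rw [← Finset.sum_smul]
    rw [Finsupp.degree_apply, Finsupp.smul_single_one]
  rw [h2]
  conv_lhs => rw [h1]
  simp only [map_sum, map_nsmul]
  exact Finset.sum_le_sum fun t ht => nsmul_le_nsmul_right (colex_single_le (h t ht)) _

variable (m : MonomialOrder σ) [CommRing R]

/-- A family of monic polynomials with pairwise distinct degrees is linearly independent. -/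
theorem linearIndependent_of_monic {v : (σ →₀ ℕ) → MvPolynomial σ R}
    (hv : ∀ e, m.Monic (v e)) (hd : ∀ e, m.degree (v e) = e) : LinearIndependent R v := by
  rw [linearIndependent_iff]
  intro l hl
  by_contra hne
  obtain ⟨e, he, hmax⟩ := l.support.exists_max_image m.toSyn (Finsupp.support_nonempty_iff.2 hne)
  have h := congrArg (coeff e) hl
  rw [Finsupp.linearCombination_apply, Finsupp.sum, coeff_sum, coeff_zero,
    Finset.sum_eq_single_of_mem e he] at h
  · have h1 : coeff e (v e) = 1 := by simpa [Monic, leadingCoeff, hd] using hv e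
    rw [coeff_smul, h1, smul_eq_mul, mul_one] at h
    exact Finsupp.mem_support_iff.1 he h
  · intro e' he' hee'
    rw [coeff_smul, m.coeff_eq_zero_of_lt, smul_zero]
    rw [hd]
    exact lt_of_le_of_ne (hmax e' he') fun h => hee' (m.toSyn.injective h)

/-- A family of monic polynomials whose degrees exhaust all exponents spans. -/
theorem span_range_eq_top_of_monic {v : (σ →₀ ℕ) → MvPolynomial σ R}
    (hv : ∀ e, m.Monic (v e)) (hd : ∀ e, m.degree (v e) = e) :
    Submodule.span R (Set.range v) = ⊤ := by
  rw [eq_top_iff]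
  rintro f -
  induction hf : m.toSyn (m.degree f) using WellFoundedLT.induction generalizing f with
  | ind a ih =>
    have hmem : m.leadingCoeff f • v (m.degree f) ∈ Submodule.span R (Set.range v) :=
      Submodule.smul_mem _ _ (Submodule.subset_span ⟨_, rfl⟩)
    set r := f - m.leadingCoeff f • v (m.degree f) with hr
    have hfr : f = r + m.leadingCoeff f • v (m.degree f) := by rw [hr]; ring
    have hcoeff : coeff (m.degree f) r = 0 := by
      have h1 : coeff (m.degree f) (v (m.degree f)) = 1 := by
        simpa [Monic, leadingCoeff, hd] using hv (m.degree f)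
      rw [hr, coeff_sub, coeff_smul, h1, smul_eq_mul, mul_one, leadingCoeff, sub_self]
    have hle : m.degree r ≼[m] m.degree f := by
      refine m.degree_sub_le.trans (sup_le le_rfl ?_)
      refine m.degree_smul_le.trans ?_
      rw [hd]
    rw [hfr]
    refine Submodule.add_mem _ ?_ hmem
    by_cases hr0 : r = 0
    · rw [hr0]
      exact Submodule.zero_mem _
    · refine ih (m.toSyn (m.degree r)) ?_ rfl
      rw [← hf]
      refine lt_of_le_of_ne hle fun h => ?_
      rw [← m.toSyn.injective h] at hcoeff
      exact hr0 (m.coeff_degree_eq_zero_iff.1 hcoeff)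

section StandardFamily

variable [Fintype σ] (g : σ → MvPolynomial σ R) (d : σ → ℕ)

/-- The remainder `x ^ (e mod d)` times the quotient `g ^ (e div d)`. -/
noncomputable def divModFamily (e : σ →₀ ℕ) : MvPolynomial σ R :=
  monomial (Finsupp.equivFunOnFinite.symm fun i => e i % d i) 1 * ∏ i, g i ^ (e i / d i)

variable {g d}

theorem monic_divModFamily (hg : ∀ i, m.Monic (g i)) (e : σ →₀ ℕ) :
    m.Monic (divModFamily g d e) := by
  refine monic_monomial_one.mul ?_
  refine Finset.prod_induction _ m.Monic (fun _ _ => Monic.mul) monic_one fun i _ => (hg i).pow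

theorem degree_divModFamily [IsDomain R] (hg : ∀ i, m.Monic (g i))
    (hd : ∀ i, m.degree (g i) = Finsupp.single i (d i)) (e : σ →₀ ℕ) :
    m.degree (divModFamily g d e) = e := by
  classical
  rw [divModFamily, m.degree_mul (m.monic_monomial_one (R := R)).ne_zero
    (Finset.prod_ne_zero_iff.2 fun i _ => (hg i).pow.ne_zero),
    m.degree_prod fun i _ => (hg i).pow.ne_zero, degree_monomial, if_neg one_ne_zero]
  ext i
  simp [degree_pow, hd, Finsupp.single_apply, Nat.mod_add_div,
    Nat.mul_comm (_ / _)]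

theorem divModFamily_of_lt {e : σ →₀ ℕ} (he : ∀ i, e i < d i) :
    divModFamily g d e = monomial e 1 := by
  have h : (Finsupp.equivFunOnFinite.symm fun i => e i % d i) = e := by
    ext i
    simp [Nat.mod_eq_of_lt (he i)]
  simp [divModFamily, h, Nat.div_eq_of_lt (he _)]

theorem mul_divModFamily (hd : ∀ i, 0 < d i) (i : σ) (e : σ →₀ ℕ) :
    g i * divModFamily g d e = divModFamily g d (e + Finsupp.single i (d i)) := by
  classical
  have h1 : ∀ j, (e + Finsupp.single i (d i)) j % d j = e j % d j := by
    intro j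
    rcases eq_or_ne i j with rfl | h
    · simp
    · simp [Finsupp.single_eq_of_ne' h]
  have h2 : ∀ j, (e + Finsupp.single i (d i)) j / d j = e j / d j + if j = i then 1 else 0 := by
    intro j
    rcases eq_or_ne j i with rfl | h
    · simp [Nat.add_div_right _ (hd j)]
    · simp [Finsupp.single_eq_of_ne h, h]
  simp only [divModFamily, h1, h2, pow_add, Finset.prod_mul_distrib, pow_ite, pow_one, pow_zero,
    Finset.prod_ite_eq', Finset.mem_univ, if_true]
  ring

/-- Monic polynomials whose leading monomials are powers of the distinct variables form a
Gröbner basis: a reduced polynomial in the ideal they generate is zero. -/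
theorem eq_zero_of_mem_span_of_reduced [IsDomain R] (hg : ∀ i, m.Monic (g i))
    (hd : ∀ i, m.degree (g i) = Finsupp.single i (d i)) (hpos : ∀ i, 0 < d i)
    {r : MvPolynomial σ R} (hr : r ∈ Ideal.span (Set.range g))
    (hred : ∀ e ∈ r.support, ∀ i, e i < d i) : r = 0 := by
  set B : (σ →₀ ℕ) → MvPolynomial σ R := divModFamily g d
  have hli : LinearIndependent R B :=
    m.linearIndependent_of_monic (m.monic_divModFamily hg) (m.degree_divModFamily hg hd)
  have hspan : Submodule.span R (Set.range B) = ⊤ :=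
    m.span_range_eq_top_of_monic (m.monic_divModFamily hg) (m.degree_divModFamily hg hd)
  let T : Set (σ →₀ ℕ) := {e | ∀ i, e i < d i}
  have hT : r ∈ Submodule.span R (B '' T) := by
    rw [r.as_sum]
    refine Submodule.sum_mem _ fun e he => ?_
    rw [← mul_one (coeff e r), ← smul_eq_mul, ← smul_monomial, ← divModFamily_of_lt (hred e he)]
    exact Submodule.smul_mem _ _ (Submodule.subset_span ⟨e, hred e he, rfl⟩)
  have hTc : r ∈ Submodule.span R (B '' Tᶜ) := by
    obtain ⟨a, rfl⟩ := Ideal.mem_span_range_iff_exists_fun.1 hr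
    refine Submodule.sum_mem _ fun i _ => ?_
    have ha : a i ∈ Submodule.span R (Set.range B) := hspan ▸ Submodule.mem_top
    generalize a i = x at ha
    induction ha using Submodule.span_induction with
    | mem x hx =>
      obtain ⟨e, rfl⟩ := hx
      rw [mul_comm, mul_divModFamily hpos]
      refine Submodule.subset_span ⟨_, fun h => ?_, rfl⟩
      simpa using h i
    | zero => simp
    | add x y _ _ hx hy => rw [add_mul]; exact Submodule.add_mem _ hx hy
    | smul c x _ hx => rw [smul_mul_assoc]; exact Submodule.smul_mem _ _ hx
  exact (Submodule.disjoint_def.1 (hli.disjoint_span_image disjoint_compl_right)) r hT hTc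

end StandardFamily

end MonomialOrder

theorem prod_map_X_eq_monomial {n : ℕ} (s : Multiset (Fin n)) :
    (s.map (X : Fin n → MvPolynomial (Fin n) ℂ)).prod = monomial (Multiset.toFinsupp s) 1 := by
  induction s using Multiset.induction_on with
  | empty => simp
  | cons a s ih =>
    rw [Multiset.map_cons, Multiset.prod_cons, ih, ← Multiset.singleton_add, map_add,
      Multiset.toFinsupp_singleton, X, monomial_mul, one_mul]

theorem card_toMultiset_eq_degree {σ : Type*} (e : σ →₀ ℕ) :
    Multiset.card (Finsupp.toMultiset e) = e.degree := by
  rw [Finsupp.card_toMultiset, Finsupp.degree_apply]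
  rfl

theorem coeff_hset {n : ℕ} (S : Finset (Fin n)) (j : ℕ) (e : Fin n →₀ ℕ)
    [Decidable (e.degree = j ∧ ∀ i, e i ≠ 0 → i ∈ S)] :
    coeff e (hset n S j) = if e.degree = j ∧ ∀ i, e i ≠ 0 → i ∈ S then 1 else 0 := by
  simp only [hset, coeff_sum, prod_map_X_eq_monomial, coeff_monomial]
  split_ifs with h
  · obtain ⟨hj, hS⟩ := h
    have hc : Multiset.card (Finsupp.toMultiset e) = j := by
      rw [card_toMultiset_eq_degree, hj]
    refine (Finset.sum_eq_single (Sym.mk (Finsupp.toMultiset e) hc) ?_ ?_).trans ?_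
    · rintro μ - hμ
      refine if_neg fun h => hμ ?_
      subst h
      ext1
      simp
    · intro h
      refine absurd (Finset.mem_filter.2 ⟨Finset.mem_univ _, fun i hi => hS i ?_⟩) h
      exact Finsupp.mem_support_iff.1 ((Finsupp.mem_toMultiset e i).1 hi)
    · exact if_pos (Finsupp.toMultiset_toFinsupp e)
  · refine Finset.sum_eq_zero fun μ hμ => if_neg fun he => h ?_
    subst he
    refine ⟨?_, fun i hi => (Finset.mem_filter.1 hμ).2 i ?_⟩
    · rw [← card_toMultiset_eq_degree, Multiset.toFinsupp_toMultiset]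
      exact μ.2
    · simpa [Multiset.count_eq_zero] using hi

theorem hset_insert_succ {n : ℕ} {S : Finset (Fin n)} {a : Fin n} (ha : a ∉ S) (j : ℕ) :
    hset n (insert a S) (j + 1) = hset n S (j + 1) + X a * hset n (insert a S) j := by
  classical
  ext e
  rw [coeff_add, coeff_X_mul', coeff_hset, coeff_hset, coeff_hset]
  by_cases hea : e a = 0
  · rw [if_neg (c := a ∈ e.support) (by simpa using hea), add_zero]
    refine if_congr (and_congr_right fun _ => forall_congr' fun i => imp_congr_right fun hi => ?_)
      rfl rfl
    have : i ≠ a := by rintro rfl; exact hi hea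
    simp [this]
  · rw [if_pos (c := a ∈ e.support) (by simpa using hea),
      if_neg (c := e.degree = j + 1 ∧ ∀ i, e i ≠ 0 → i ∈ S) (fun h => ha (h.2 a hea)), zero_add]
    obtain ⟨f, rfl⟩ : ∃ f, e = f + Finsupp.single a 1 :=
      ⟨e - Finsupp.single a 1, (tsub_add_cancel_of_le (by
        rw [Finsupp.single_le_iff]; exact Nat.one_le_iff_ne_zero.2 hea)).symm⟩
    rw [add_tsub_cancel_right]
    refine if_congr (and_congr (by simp) (forall_congr' fun i => ?_)) rfl rfl
    rcases eq_or_ne i a with rfl | hi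
    · simp
    · simp [Finsupp.single_eq_of_ne hi]

theorem hfirst_succ_succ {n k : ℕ} (hk : k < n) (j : ℕ) :
    hfirst n (k + 1) (j + 1) = hfirst n k (j + 1) + X ⟨k, hk⟩ * hfirst n (k + 1) j := by
  have h : Finset.univ.filter (fun i : Fin n => (i : ℕ) < k + 1) =
      insert ⟨k, hk⟩ (Finset.univ.filter (fun i : Fin n => (i : ℕ) < k)) := by
    ext i
    simp [Fin.ext_iff]
    omega
  rw [hfirst, hfirst, hfirst, h]
  exact hset_insert_succ (by simp) j

theorem coeff_single_hfirst {n : ℕ} (i : Fin n) (j : ℕ) :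
    coeff (Finsupp.single i j) (hfirst n (i + 1) j) = 1 := by
  classical
  rw [hfirst, coeff_hset, if_pos]
  refine ⟨by simp, fun k hk => ?_⟩
  have : k = i := by
    by_contra h
    exact hk (Finsupp.single_eq_of_ne h)
  simp [this]

theorem degree_hfirst {n : ℕ} (i : Fin n) (j : ℕ) :
    MonomialOrder.colex.degree (hfirst n (i + 1) j) = Finsupp.single i j := by
  classical
  apply MonomialOrder.colex.toSyn.injective
  refine le_antisymm (MonomialOrder.degree_le_iff.2 fun e he => ?_)
    (MonomialOrder.le_degree (by simp [coeff_single_hfirst]))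
  rw [mem_support_iff, hfirst, coeff_hset] at he
  obtain ⟨rfl, hS⟩ := of_not_not fun h => he (if_neg h)
  refine MonomialOrder.colex_le_single_degree fun t ht => ?_
  have := hS t (Finsupp.mem_support_iff.1 ht)
  simp only [Finset.mem_filter, Finset.mem_univ, true_and] at this
  exact Fin.le_def.2 (by omega)

theorem monic_hfirst {n : ℕ} (i : Fin n) (j : ℕ) :
    MonomialOrder.colex.Monic (hfirst n (i + 1) j) := by
  rw [MonomialOrder.Monic, MonomialOrder.leadingCoeff, degree_hfirst, coeff_single_hfirst]

theorem hfirst_mem_Ib {n : ℕ} (b : Fin n → ℕ) (i : Fin n) : hfirst n (i + 1) (b i) ∈ Ib b :=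
  Ideal.subset_span ⟨i, rfl⟩

/-- Multiplying by the variables of index `a + 1, …, k` lowers by one the degree needed
for a complete homogeneous symmetric polynomial to lie in the ideal. -/
theorem prod_X_mul_hfirst_mem_Ib {n : ℕ} {b : Fin n → ℕ} (hb : Bprime b) {a : ℕ}
    (ha : a + 1 < n) (hab : b ⟨a, Nat.lt_of_succ_lt ha⟩ = b ⟨a + 1, ha⟩) (k : ℕ) (hk : k < n)
    (hak : a + 1 ≤ k) :
    (∏ t ∈ Finset.univ.filter (fun t : Fin n => a + 1 ≤ (t : ℕ) ∧ (t : ℕ) < k + 1), X t) *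
      hfirst n (k + 1) (b ⟨k, hk⟩ - 1) ∈ Ib b := by
  have key : ∀ k (hk : k < n), a + 1 ≤ k →
      (∏ t ∈ Finset.univ.filter (fun t : Fin n => a + 1 ≤ (t : ℕ) ∧ (t : ℕ) < k), X t) *
        hfirst n k (b ⟨k, hk⟩) ∈ Ib b →
      (∏ t ∈ Finset.univ.filter (fun t : Fin n => a + 1 ≤ (t : ℕ) ∧ (t : ℕ) < k + 1), X t) *
        hfirst n (k + 1) (b ⟨k, hk⟩ - 1) ∈ Ib b := by
    intro k hk hak h
    obtain ⟨c, hc⟩ := Nat.exists_eq_add_of_lt (hb.1 ⟨k, hk⟩)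
    rw [zero_add] at hc
    have hS : Finset.univ.filter (fun t : Fin n => a + 1 ≤ (t : ℕ) ∧ (t : ℕ) < k + 1) =
        insert ⟨k, hk⟩ (Finset.univ.filter fun t : Fin n => a + 1 ≤ (t : ℕ) ∧ (t : ℕ) < k) := by
      ext i
      simp [Fin.ext_iff]
      omega
    have hmem := hfirst_mem_Ib b ⟨k, hk⟩
    simp only [hc] at h hmem ⊢
    rw [hfirst_succ_succ hk] at hmem
    rw [hS, Finset.prod_insert (by simp), Nat.add_sub_cancel]
    have := Ideal.sub_mem _ (Ideal.mul_mem_left _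
      (∏ t ∈ Finset.univ.filter (fun t : Fin n => a + 1 ≤ (t : ℕ) ∧ (t : ℕ) < k), X t) hmem) h
    convert this using 1
    ring
  induction k, hak using Nat.le_induction with
  | base =>
    refine key _ hk le_rfl (Ideal.mul_mem_left _ _ ?_)
    rw [← hab]
    exact hfirst_mem_Ib b ⟨a, Nat.lt_of_succ_lt hk⟩
  | succ k hak ih =>
    refine key _ hk (by omega) ?_
    obtain ⟨h1, h2⟩ := hb.2 k hk
    rcases h1.eq_or_lt with h | h
    · rw [h]
      exact Ideal.mul_mem_left _ _ (hfirst_mem_Ib b ⟨k, Nat.lt_of_succ_lt hk⟩)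
    · have : b ⟨k + 1, hk⟩ = b ⟨k, Nat.lt_of_succ_lt hk⟩ - 1 := by omega
      rw [this]
      exact ih (Nat.lt_of_succ_lt hk)

/-- Let `b` be a weakly decreasing sequence of positive integers with consecutive
differences at most one and `b_n = 1`, and let `m` be an index with `b_{m−1} = b_m`
(1-based).  If the monomial `x_m x_{m+1} ⋯ x_{m+ℓ}` (1-based positions, i.e. 0-based
indices `m-1, …, m+ℓ-1`) divides `p`, then it divides every basis monomial occurring
with nonzero coefficient in the expansion of the class of `p` in `R_b = R/I_b` in the
monomial basis `{x_1^{j_1} ⋯ x_n^{j_n} : 0 ≤ j_i < b_i}`. -/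
theorem stmt15 {n : ℕ} (b : Fin n → ℕ) (hb : Bprime b)
    (m : ℕ) (hm2 : 2 ≤ m) (hmn : m ≤ n)
    (hlast : b ⟨n - 1, by omega⟩ = 1)
    (hbm : b ⟨m - 2, by omega⟩ = b ⟨m - 1, by omega⟩)
    (ℓ : ℕ) (hml : m + ℓ ≤ n)
    (p : MvPolynomial (Fin n) ℂ)
    (hdvd : (∏ t ∈ Finset.univ.filter (fun t : Fin n => m - 1 ≤ (t : ℕ) ∧ (t : ℕ) < m + ℓ),
        X t) ∣ p)
    (c : ((i : Fin n) → Fin (b i)) → ℂ)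
    (hc : Ideal.Quotient.mk (Ib b) p =
      ∑ j : (i : Fin n) → Fin (b i),
        c j • Ideal.Quotient.mk (Ib b)
          (monomial (Finsupp.equivFunOnFinite.symm fun i => (j i : ℕ)) 1)) :
    ∀ j, c j ≠ 0 → ∀ t : Fin n, m - 1 ≤ (t : ℕ) → (t : ℕ) < m + ℓ → 1 ≤ (j t : ℕ) := by
    classical
  obtain ⟨a, rfl⟩ : ∃ a, m = a + 2 := ⟨m - 2, by omega⟩
  simp only [Nat.add_sub_cancel, show a + 2 - 1 = a + 1 by omega] at hbm hdvd ⊢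
  set S := Finset.univ.filter (fun t : Fin n => a + 1 ≤ (t : ℕ) ∧ (t : ℕ) < a + 2 + ℓ) with hS
  set d : Fin n → ℕ := fun i => if i ∈ S then b i - 1 else b i with hd
  set g : Fin n → MvPolynomial (Fin n) ℂ := fun i => hfirst n (i + 1) (d i) with hg
  have hgI : ∀ i, (∏ t ∈ S, X t) * g i ∈ Ib b := by
    intro i
    by_cases hi : i ∈ S
    · have hi' : a + 1 ≤ (i : ℕ) ∧ (i : ℕ) < a + 2 + ℓ := by simpa [hS] using hi
      have h := prod_X_mul_hfirst_mem_Ib hb (by omega) hbm i i.2 hi'.1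
      have hsub : Finset.univ.filter (fun t : Fin n => a + 1 ≤ (t : ℕ) ∧ (t : ℕ) < i + 1) ⊆ S := by
        intro t
        simp only [hS, Finset.mem_filter, Finset.mem_univ, true_and]
        omega
      rw [← Finset.prod_sdiff hsub, mul_assoc]
      simpa [hg, hd, hi] using Ideal.mul_mem_left _ _ h
    · refine Ideal.mul_mem_left _ _ ?_
      simpa [hg, hd, hi] using hfirst_mem_Ib b i
  obtain ⟨q, rfl⟩ := hdvd
  obtain ⟨f, r, rfl, -, hr⟩ := MonomialOrder.colex.div (b := g)
    (fun i => by rw [(monic_hfirst i (d i)).leadingCoeff_eq_one]; exact isUnit_one) q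
  simp only [hg, degree_hfirst, Finsupp.single_le_iff, not_le] at hr
  set u : Fin n →₀ ℕ := ∑ t ∈ S, Finsupp.single t 1 with hu
  have huS : ∀ i, u i = if i ∈ S then 1 else 0 := by
    intro i
    simp [hu, Finsupp.finsetSum_apply, Finsupp.single_apply]
  have hprod : (∏ t ∈ S, X t : MvPolynomial (Fin n) ℂ) = monomial u 1 := by
    rw [hu, monomial_sum_one]
    rfl
  set w : MvPolynomial (Fin n) ℂ := ∑ j : (i : Fin n) → Fin (b i),
    monomial (Finsupp.equivFunOnFinite.symm fun i => (j i : ℕ)) (c j) with hw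
  have hwr : w - (∏ t ∈ S, X t) * r ∈ Ib b := by
    have h1 : (∏ t ∈ S, X t) * Finsupp.linearCombination _ g f ∈ Ib b := by
      rw [Finsupp.linearCombination_apply, Finsupp.sum, Finset.mul_sum]
      refine Ideal.sum_mem _ fun i _ => ?_
      rw [smul_eq_mul, mul_left_comm]
      exact Ideal.mul_mem_left _ _ (hgI i)
    have h2 : Ideal.Quotient.mk (Ib b) w = ∑ j : (i : Fin n) → Fin (b i),
        c j • Ideal.Quotient.mk (Ib b)
          (monomial (Finsupp.equivFunOnFinite.symm fun i => (j i : ℕ)) 1) := by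
      rw [hw, map_sum]
      refine Finset.sum_congr rfl fun j _ => ?_
      rw [← Ideal.Quotient.mkₐ_eq_mk ℂ, ← map_smul, smul_monomial, smul_eq_mul, mul_one]
    rw [← h2, eq_comm, Ideal.Quotient.eq, mul_add] at hc
    have := Ideal.add_mem _ hc h1
    convert this using 1
    ring
  have hzero : w - (∏ t ∈ S, X t) * r = 0 := by
    refine MonomialOrder.colex.eq_zero_of_mem_span_of_reduced (d := b)
      (fun i => monic_hfirst i (b i)) (fun i => degree_hfirst i (b i)) hb.1 hwr fun e he i => ?_
    by_contra! hlt
    have hw0 : coeff e w = 0 := by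
      rw [hw, coeff_sum]
      refine Finset.sum_eq_zero fun j _ => ?_
      rw [coeff_monomial, if_neg]
      rintro rfl
      exact absurd (j i).2 (not_lt.2 hlt)
    rw [mem_support_iff, coeff_sub, hw0, zero_sub, neg_ne_zero, hprod, coeff_monomial_mul',
      one_mul] at he
    have hle : u ≤ e := by
      by_contra h
      exact he (if_neg h)
    rw [if_pos hle] at he
    have h1 := hr _ (mem_support_iff.2 he) i
    have h2 := hb.1 i
    rw [Finsupp.tsub_apply, huS] at h1
    by_cases hi : i ∈ S <;> simp only [hd, hi, if_true, if_false] at h1 <;> omega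
  intro j hj t ht1 ht2
  have hcj : coeff (Finsupp.equivFunOnFinite.symm fun i => (j i : ℕ)) w = c j := by
    rw [hw, coeff_sum, Finset.sum_eq_single j]
    · simp
    · intro j' _ hj'
      rw [coeff_monomial, if_neg]
      intro h
      apply hj'
      ext i
      simpa using DFunLike.congr_fun h i
    · simp
  rw [← hcj, sub_eq_zero.1 hzero, hprod, coeff_monomial_mul'] at hj
  have hle := (of_not_not fun h => hj (if_neg h)) t
  rw [huS, if_pos (Finset.mem_filter.2 ⟨Finset.mem_univ _, ht1, ht2⟩)] at hle
  simpa using hle
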